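/- arXiv:1708.07172 — 2 statements merged into one kernel-verified Lean document; each statement's English description precedes it below -/
import Mathlib

section
/- Let B : [0,∞) → ℝ be a continuous function and let ℓ : ℝ × [0,∞) → [0,∞) be a jointly continuous function such that for every y ∈ ℝ and every t ≥ 0, ℓ(y,t) = lim_{ε→0⁺} (2ε)⁻¹ · Leb{u ∈ [0,t] : |B(u) − y| < ε}, and such that for every y ∈ ℝ, sup_{t≥0} ℓ(y,t) = ∞. Then the map K(t) := (B(t), ℓ(B(t), t)) is continuous on [0,∞) and its range is the entire closed upper half-plane: {K(t) : t ≥ 0} = ℝ × [0,∞). -/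
open MeasureTheory Filter Set

/-- The occupation-density property: `ℓ y t` is the limit as `ε → 0⁺` of
`(2ε)⁻¹ · Leb {u ∈ [0,t] : |B u − y| < ε}`. -/
def OccupationDensity (B : ℝ → ℝ) (ℓ : ℝ → ℝ → ℝ) : Prop :=
  ∀ y t : ℝ, 0 ≤ t →
    Tendsto (fun ε : ℝ =>
        (volume {u ∈ Icc (0:ℝ) t | |B u - y| < ε}).toReal / (2 * ε))
      (nhdsWithin 0 (Ioi 0)) (nhds (ℓ y t))

/-- The occupation density at time `0` vanishes. -/
theorem OccupationDensity.zero {B : ℝ → ℝ} {ℓ : ℝ → ℝ → ℝ} (hocc : OccupationDensity B ℓ)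
    (y : ℝ) : ℓ y 0 = 0 := by
  refine tendsto_nhds_unique (hocc y 0 le_rfl) (tendsto_const_nhds.congr fun ε => ?_)
  have hnull : volume {u ∈ Icc (0 : ℝ) 0 | |B u - y| < ε} = 0 :=
    measure_mono_null (sep_subset _ _) (by simp)
  rw [hnull, ENNReal.toReal_zero, zero_div]

/-- The occupation density is nondecreasing in time. -/
theorem OccupationDensity.mono {B : ℝ → ℝ} {ℓ : ℝ → ℝ → ℝ} (hocc : OccupationDensity B ℓ)
    (y : ℝ) {s t : ℝ} (hs : 0 ≤ s) (hst : s ≤ t) : ℓ y s ≤ ℓ y t := by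
  refine le_of_tendsto_of_tendsto (hocc y s hs) (hocc y t (hs.trans hst)) ?_
  filter_upwards [self_mem_nhdsWithin] with ε (hε : 0 < ε)
  have hfin : volume {u ∈ Icc (0 : ℝ) t | |B u - y| < ε} ≠ ⊤ :=
    measure_ne_top_of_subset (sep_subset _ _) (by simp)
  have hsub : {u ∈ Icc (0 : ℝ) s | |B u - y| < ε} ⊆ {u ∈ Icc (0 : ℝ) t | |B u - y| < ε} :=
    fun u hu => ⟨⟨hu.1.1, hu.1.2.trans hst⟩, hu.2⟩
  have := ENNReal.toReal_mono hfin (measure_mono hsub)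
  gcongr

/-- The occupation density at `y` does not change while the path stays away from `y`. -/
theorem OccupationDensity.eq_of_le_abs_sub {B : ℝ → ℝ} {ℓ : ℝ → ℝ → ℝ}
    (hocc : OccupationDensity B ℓ) {y s t δ : ℝ} (hs : 0 ≤ s) (hst : s ≤ t) (hδ : 0 < δ)
    (haway : ∀ u ∈ Icc s t, δ ≤ |B u - y|) : ℓ y t = ℓ y s := by
  refine tendsto_nhds_unique_of_eventuallyEq (hocc y t (hs.trans hst)) (hocc y s hs) ?_
  filter_upwards [mem_nhdsWithin_of_mem_nhds (Iio_mem_nhds hδ)] with ε (hε : ε < δ)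
  have hset : {u ∈ Icc (0 : ℝ) t | |B u - y| < ε} = {u ∈ Icc (0 : ℝ) s | |B u - y| < ε} := by
    ext u
    refine ⟨fun hu => ⟨⟨hu.1.1, ?_⟩, hu.2⟩, fun hu => ⟨⟨hu.1.1, hu.1.2.trans hst⟩, hu.2⟩⟩
    by_contra! hsu
    exact (haway u ⟨hsu.le, hu.1.2⟩).not_gt (hu.2.trans hε)
  rw [hset]

theorem brownian_bricklayer_space_filling
    (B : ℝ → ℝ) (ℓ : ℝ → ℝ → ℝ)
    (hB : ContinuousOn B (Ici 0))
    (hℓnn : ∀ y t : ℝ, 0 ≤ t → 0 ≤ ℓ y t)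
    (hℓcont : ContinuousOn (fun p : ℝ × ℝ => ℓ p.1 p.2) (univ ×ˢ Ici 0))
    (hocc : OccupationDensity B ℓ)
    (hunb : ∀ y M : ℝ, ∃ t : ℝ, 0 ≤ t ∧ M < ℓ y t) :
    ContinuousOn (fun t => (B t, ℓ (B t) t)) (Ici 0) ∧
      (fun t => (B t, ℓ (B t) t)) '' Ici 0 = univ ×ˢ Ici 0 := by
  refine ⟨hB.prodMk (hℓcont.comp (hB.prodMk continuousOn_id) fun t ht => ⟨mem_univ _, ht⟩), ?_⟩
  refine Subset.antisymm ?_ ?_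
  · rintro _ ⟨t, ht, rfl⟩
    exact ⟨mem_univ _, hℓnn _ _ ht⟩
  rintro ⟨y, h⟩ ⟨-, hh : 0 ≤ h⟩
  have hℓy : ContinuousOn (ℓ y) (Ici 0) :=
    hℓcont.comp (f := fun t : ℝ => (y, t)) (by fun_prop) fun t ht => ⟨mem_univ _, ht⟩
  -- The last time at which the local time at `y` is at most `h`.
  set S : Set ℝ := Ici 0 ∩ ℓ y ⁻¹' Iic h
  have hclosed : IsClosed S := hℓy.preimage_isClosed_of_isClosed isClosed_Ici isClosed_Iic
  have hne : S.Nonempty := ⟨0, self_mem_Ici, by simpa [hocc.zero y] using hh⟩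
  have hbdd : BddAbove S := by
    obtain ⟨T, hT, hhT⟩ := hunb y h
    refine ⟨T, fun t ht => ?_⟩
    by_contra! hTt
    exact (hhT.trans_le (hocc.mono y hT hTt.le)).not_ge ht.2
  obtain ⟨hb0 : 0 ≤ sSup S, hbh : ℓ y (sSup S) ≤ h⟩ := hclosed.csSup_mem hne hbdd
  set b := sSup S
  have hlast : ∀ t, b < t → h < ℓ y t := fun t hbt => by
    by_contra! hle
    exact (le_csSup hbdd ⟨hb0.trans hbt.le, hle⟩).not_gt hbt
  have hsub : Ioi b ⊆ Ici 0 := fun t ht => hb0.trans (le_of_lt ht)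
  have hℓb : ℓ y b = h := by
    refine hbh.antisymm (ge_of_tendsto ((hℓy b hb0).mono_left (nhdsWithin_mono b hsub)) ?_)
    filter_upwards [self_mem_nhdsWithin] with t ht using (hlast t ht).le
  have hBb : B b = y := by
    by_contra hBy
    have hpos : 0 < |B b - y| := abs_pos.2 (sub_ne_zero.2 hBy)
    have hcont : ContinuousWithinAt (fun u => |B u - y|) (Ici b) b :=
      (((hB b hb0).mono (Ici_subset_Ici.2 hb0)).sub_const y).abs
    have hev : ∀ᶠ u in nhdsWithin b (Ici b), |B b - y| / 2 < |B u - y| :=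
      hcont.eventually (lt_mem_nhds (half_lt_self hpos))
    obtain ⟨t, hbt, hIcc⟩ := mem_nhdsGE_iff_exists_Icc_subset.1 hev
    have := hocc.eq_of_le_abs_sub hb0 (le_of_lt hbt) (half_pos hpos)
      fun u hu => le_of_lt (hIcc hu)
    exact (hlast t hbt).ne' (this.trans hℓb)
  exact ⟨b, hb0, by simp only [hBb, hℓb]⟩
end

section
/- Let B : [0,∞) → ℝ be a continuous function and let ℓ : ℝ × [0,∞) → [0,∞) be a jointly continuous function such that for every y ∈ ℝ and every t ≥ 0, ℓ(y,t) = lim_{ε→0⁺} (2ε)⁻¹ · Leb{u ∈ [0,t] : |B(u) − y| < ε}, and assume in addition that for every t ≥ 0 the function y ↦ ℓ(y,t) is a density with respect to Lebesgue measure of the occupation measure A ↦ Leb{u ∈ [0,t] : B(u) ∈ A}. Set K(u) := (B(u), ℓ(B(u), u)). Then for every t ≥ 0, the two-dimensional Lebesgue measure of the set {K(u) : u ∈ [0,t]} equals t. In particular, ∫_ℝ ℓ(y,t) dy = t. -/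
open MeasureTheory Filter Set

/-- For each `t ≥ 0`, `y ↦ ℓ y t` is a density, with respect to Lebesgue measure,
of the occupation measure `A ↦ Leb {u ∈ [0,t] : B u ∈ A}`. -/
def OccupationMeasureDensity (B : ℝ → ℝ) (ℓ : ℝ → ℝ → ℝ) : Prop :=
  ∀ t : ℝ, 0 ≤ t → ∀ A : Set ℝ, MeasurableSet A →
    volume {u ∈ Icc (0:ℝ) t | B u ∈ A} = ∫⁻ y in A, ENNReal.ofReal (ℓ y t)

/-- The local time at `y` does not grow while `B` stays away from `y`. -/
theorem OccupationDensity.eq_of_forall_ne {B : ℝ → ℝ} {ℓ : ℝ → ℝ → ℝ}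
    (hocc : OccupationDensity B ℓ) (hB : ContinuousOn B (Ici 0)) (y : ℝ) {s t : ℝ}
    (hs : 0 ≤ s) (hst : s ≤ t) (hne : ∀ u ∈ Icc s t, B u ≠ y) : ℓ y s = ℓ y t := by
  have hcont : ContinuousOn (fun u => |B u - y|) (Icc s t) :=
    ((hB.mono fun u hu => hs.trans hu.1).sub continuousOn_const).abs
  obtain ⟨v, hv, hmin⟩ := isCompact_Icc.exists_isMinOn (nonempty_Icc.2 hst) hcont
  have hpos : 0 < |B v - y| := abs_pos.2 (sub_ne_zero.2 (hne v hv))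
  refine tendsto_nhds_unique (hocc y s hs) ((hocc y t (hs.trans hst)).congr' ?_)
  filter_upwards [nhdsWithin_le_nhds (Iio_mem_nhds hpos)] with ε hε
  have hset : {u ∈ Icc (0:ℝ) t | |B u - y| < ε} = {u ∈ Icc (0:ℝ) s | |B u - y| < ε} := by
    ext u
    refine ⟨fun hu => ⟨⟨hu.1.1, ?_⟩, hu.2⟩, fun hu => ⟨⟨hu.1.1, hu.1.2.trans hst⟩, hu.2⟩⟩
    by_contra! hsu
    exact lt_irrefl _ ((hmin ⟨hsu.le, hu.1.2⟩).trans_lt (hu.2.trans hε))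
  rw [hset]

/-- Every positive level up to `ℓ y t` is attained by `ℓ y` at a time when `B` visits `y`. -/
theorem OccupationDensity.exists_visit {B : ℝ → ℝ} {ℓ : ℝ → ℝ → ℝ}
    (hocc : OccupationDensity B ℓ) (hB : ContinuousOn B (Ici 0)) (y : ℝ)
    (hcont : ContinuousOn (ℓ y) (Ici 0)) {t a : ℝ} (ht : 0 ≤ t) (ha : 0 < a) (hat : a ≤ ℓ y t) :
    ∃ r ∈ Icc 0 t, B r = y ∧ ℓ y r = a := by
  have hcont' : ContinuousOn (ℓ y) (Icc 0 t) := hcont.mono fun u hu => hu.1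
  obtain ⟨w, hw, hwa⟩ := intermediate_value_Icc ht hcont' ⟨by rw [hocc.zero]; exact ha.le, hat⟩
  have hcompact : IsCompact (Icc 0 t ∩ ℓ y ⁻¹' {a}) :=
    isCompact_Icc.of_isClosed_subset
      (hcont'.preimage_isClosed_of_isClosed isClosed_Icc isClosed_singleton) inter_subset_left
  obtain ⟨r, ⟨hr, hra⟩, hleast⟩ := hcompact.exists_isLeast ⟨w, hw, hwa⟩
  refine ⟨r, hr, ?_, hra⟩
  by_contra hne
  have hr0 : 0 < r := hr.1.lt_of_ne <| by
    rintro rfl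
    exact ha.ne ((hocc.zero y).symm.trans hra)
  have hev : ∀ᶠ u in nhds r, B u ≠ y :=
    (hB.continuousAt (Ici_mem_nhds hr0)).eventually_ne hne
  obtain ⟨c, hcr, hc⟩ := exists_Ioc_subset_of_mem_nhds (hev.and (Ioi_mem_nhds hr0)) ⟨0, hr0⟩
  obtain ⟨s, hcs, hsr⟩ := exists_between hcr
  have hs0 : 0 ≤ s := (hc ⟨hcs, hsr.le⟩).2.le
  have hconst : ℓ y s = ℓ y r :=
    hocc.eq_of_forall_ne hB y hs0 hsr.le fun u hu => (hc ⟨hcs.trans_le hu.1, hu.2⟩).1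
  exact hsr.not_ge (hleast ⟨⟨hs0, hsr.le.trans hr.2⟩, hconst.trans hra⟩)

theorem bricklayer_unit_area_growth
    (B : ℝ → ℝ) (ℓ : ℝ → ℝ → ℝ)
    (hB : ContinuousOn B (Ici 0))
    (hℓnn : ∀ y t : ℝ, 0 ≤ t → 0 ≤ ℓ y t)
    (hℓcont : ContinuousOn (fun p : ℝ × ℝ => ℓ p.1 p.2) (univ ×ˢ Ici 0))
    (hocc : OccupationDensity B ℓ)
    (hdens : OccupationMeasureDensity B ℓ) :
    ∀ t : ℝ, 0 ≤ t →
      volume ((fun u => (B u, ℓ (B u) u)) '' Icc 0 t) = ENNReal.ofReal t ∧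
        ∫ y : ℝ, ℓ y t = t := by
  intro t ht
  have hmass : ∫⁻ y, ENNReal.ofReal (ℓ y t) = ENNReal.ofReal t := by
    have h := hdens t ht univ MeasurableSet.univ
    simp only [mem_univ, and_true, ofPred_mem_eq, Real.volume_Icc, sub_zero,
      setLIntegral_univ] at h
    exact h.symm
  have hspace : Continuous fun y => ℓ y t :=
    hℓcont.comp_continuous (f := fun y : ℝ => (y, t)) (by fun_prop) fun y => ⟨mem_univ _, ht⟩
  have htime (y : ℝ) : ContinuousOn (ℓ y) (Ici 0) :=
    hℓcont.comp (f := fun u : ℝ => (y, u)) (by fun_prop) fun u hu => ⟨mem_univ _, hu⟩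
  refine ⟨le_antisymm ?_ ?_, ?_⟩
  · have hmeas : MeasurableSet {p : ℝ × ℝ | p.2 ∈ Icc 0 (ℓ p.1 t)} :=
      ((isClosed_le continuous_const continuous_snd).inter
        (isClosed_le continuous_snd (hspace.comp continuous_fst))).measurableSet
    calc volume ((fun u => (B u, ℓ (B u) u)) '' Icc 0 t)
        ≤ volume {p : ℝ × ℝ | p.2 ∈ Icc 0 (ℓ p.1 t)} := by
          refine measure_mono ?_
          rintro _ ⟨u, hu, rfl⟩
          exact ⟨hℓnn _ _ hu.1, hocc.mono _ hu.1 hu.2⟩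
      _ = ∫⁻ y, volume (Icc 0 (ℓ y t)) := by
          rw [Measure.volume_eq_prod, Measure.prod_apply hmeas]
          rfl
      _ = ENNReal.ofReal t := by simp [hmass]
  · calc ENNReal.ofReal t
        = volume (regionBetween (fun _ => 0) (fun y => ℓ y t) univ) := by
          rw [Measure.volume_eq_prod, volume_regionBetween_eq_lintegral aemeasurable_const
            hspace.aemeasurable MeasurableSet.univ, setLIntegral_univ, ← hmass]
          simp
      _ ≤ volume ((fun u => (B u, ℓ (B u) u)) '' Icc 0 t) := by
          refine measure_mono ?_
          rintro ⟨y, a⟩ ⟨-, ha, hat⟩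
          obtain ⟨r, hr, rfl, rfl⟩ := hocc.exists_visit hB y (htime y) ht ha hat.le
          exact ⟨r, hr, rfl⟩
  · rw [integral_eq_lintegral_of_nonneg_ae (.of_forall fun y => hℓnn y t ht)
      hspace.aestronglyMeasurable, hmass, ENNReal.toReal_ofReal ht]
end
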